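/- For every integer constant c ≥ 0 there exists n0 such that for every n ≥ n0 and every integer k with |2k − n| ≤ c, there exists a CNF formula ucp-equivalent to Ψ_{n,k} with at most 6·(k+1)·C(n, k+1, k) clauses. -/

import Mathlib

/-- A literal on variables `x_1, …, x_n`: a variable together with a polarity
(`true` = positive literal, `false` = negative literal). -/
abbrev Lit (n : ℕ) := Fin n × Bool

/-- A clause is a finite set of literals. -/
abbrev Clause (n : ℕ) := Finset (Lit n)

/-- A CNF formula is a finite set of clauses. -/
abbrev CnfFormula (n : ℕ) := Finset (Clause n)

/-- Negation of a literal. -/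
def negLit {n : ℕ} (l : Lit n) : Lit n := (l.1, !l.2)

/-- A clause is well-formed if its literals are on pairwise distinct variables. -/
def Clause.Wf {n : ℕ} (C : Clause n) : Prop :=
  ∀ l ∈ C, ∀ l' ∈ C, l.1 = l'.1 → l = l'

/-- A partial assignment: a set of literals containing no complementary pair. -/
def IsPartialAssignment {n : ℕ} (α : Finset (Lit n)) : Prop :=
  ∀ l ∈ α, negLit l ∉ α

/-- The set of unit clauses corresponding to a set of literals. -/
def unitClauses {n : ℕ} (α : Finset (Lit n)) : CnfFormula n :=
  α.image (fun l => {l})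

/-- `UcpDeriv φ l` says that `l` lies in the least set `U` of literals closed under
the rule: if `C ∈ φ`, `l ∈ C`, and the negation of every literal of `C \ {l}`
lies in `U`, then `l ∈ U`. -/
inductive UcpDeriv {n : ℕ} (φ : CnfFormula n) : Lit n → Prop
  | step (C : Clause n) (hC : C ∈ φ) (l : Lit n) (hl : l ∈ C)
      (h : ∀ l' ∈ C.erase l, UcpDeriv φ (negLit l')) : UcpDeriv φ l

/-- The set of literals derived by unit clause propagation on `φ`. -/
def UcpSet {n : ℕ} (φ : CnfFormula n) : Set (Lit n) := {l | UcpDeriv φ l}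

/-- UCP on `φ` reaches the contradiction `⊥`: for some clause `C ∈ φ`, the negation of
every literal of `C` is derived. -/
def UcpBot {n : ℕ} (φ : CnfFormula n) : Prop :=
  ∃ C ∈ φ, ∀ l ∈ C, UcpDeriv φ (negLit l)

/-- Formulas `φ₁` and `φ₂` are ucp-equivalent: for every partial assignment `α`,
`UCP(φ₁ ∪ α) = UCP(φ₂ ∪ α)` (either both are `{⊥}`, or neither is and the derived
sets of literals coincide). -/
def UcpEquiv {n : ℕ} (φ₁ φ₂ : CnfFormula n) : Prop :=
  ∀ α : Finset (Lit n), IsPartialAssignment α →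
    (UcpBot (φ₁ ∪ unitClauses α) ↔ UcpBot (φ₂ ∪ unitClauses α)) ∧
    (¬ UcpBot (φ₁ ∪ unitClauses α) →
      UcpSet (φ₁ ∪ unitClauses α) = UcpSet (φ₂ ∪ unitClauses α))

/-- A total assignment satisfies a literal. -/
def SatLit {n : ℕ} (a : Fin n → Bool) (l : Lit n) : Prop := a l.1 = l.2

/-- A total assignment satisfies a clause if it satisfies some literal of it. -/
def SatClause {n : ℕ} (a : Fin n → Bool) (C : Clause n) : Prop := ∃ l ∈ C, SatLit a l

/-- A total assignment satisfies a formula if it satisfies every clause of it. -/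
def SatFormula {n : ℕ} (a : Fin n → Bool) (φ : CnfFormula n) : Prop :=
  ∀ C ∈ φ, SatClause a C


instance {n : ℕ} (C : Clause n) : Decidable (Clause.Wf C) :=
  decidable_of_iff (∀ l ∈ C, ∀ l' ∈ C, l.1 = l'.1 → l = l') Iff.rfl

/-- `Ψ_{n,k}`: the CNF formula on `x₁, …, xₙ` consisting of all clauses (on pairwise
distinct variables) containing exactly `k` negative literals and one positive literal. -/
def Psi (n k : ℕ) : CnfFormula n :=
  Finset.univ.filter (fun C : Clause n =>
    Clause.Wf C ∧ (C.filter (fun l => l.2 = false)).card = k ∧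
      (C.filter (fun l => l.2 = true)).card = 1)

/-- `F` is a covering system witnessing `C(n, r, k)`: a family of `r`-element subsets of an
`n`-element set such that every `k`-element subset is contained in at least one member. -/
def IsCoveringSystem (n r k : ℕ) (F : Finset (Finset (Fin n))) : Prop :=
  (∀ e ∈ F, e.card = r) ∧ ∀ s : Finset (Fin n), s.card = k → ∃ e ∈ F, s ⊆ e

/-- The covering number `C(n, r, k)`: the smallest size of a family of `r`-element subsets
of an `n`-element set such that every `k`-element subset is contained in at least one
member of the family. -/
noncomputable def coverNum (n r k : ℕ) : ℕ :=
  sInf {m | ∃ F : Finset (Finset (Fin n)), IsCoveringSystem n r k F ∧ F.card = m}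

open Finset

/-- `S` is closed in the link of `B` in `F`: no member of `F` has the form `B ∪ {v, w}` with
`v ∈ S` and `w` outside `S ∪ B`. -/
def LinkClosed {n : ℕ} (F : Finset (Finset (Fin n))) (B S : Finset (Fin n)) : Prop :=
  ∀ v ∈ S, ∀ w ∉ S, w ∉ B → insert v (insert w B) ∉ F

/-- Every link of an `m`-element set in `F` is connected. -/
def LinksConnected {n : ℕ} (F : Finset (Finset (Fin n))) (m : ℕ) : Prop :=
  ∀ B S : Finset (Fin n), B.card = m → S.Nonempty → Disjoint S B → LinkClosed F B S →
    ∀ v, v ∈ S ∨ v ∈ B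

section ClosedSets

variable {V : Type*} [Fintype V] [DecidableEq V]

/-- In a finite graph without isolated vertices, the number of closed sets of size `s` is at most
the square root of the number of all sets of size `s`. -/
theorem sq_card_closed_le_choose (r : V → V → Prop) (hr : ∀ v, ∃ w, w ≠ v ∧ r v w)
    (s : ℕ) (𝒞 : Finset (Finset V)) (hs : ∀ S ∈ 𝒞, S.card = s)
    (h𝒞 : ∀ S ∈ 𝒞, ∀ v w, r v w → (v ∈ S ↔ w ∈ S)) :
    𝒞.card ^ 2 ≤ (Fintype.card V).choose s := by
  classical
  let Q := Quotient (Relation.EqvGen.setoid r)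
  let x : Q → V := Quotient.out
  choose f hf using hr
  let y : Q → V := fun q => f (x q)
  have hx : ∀ q, (Quotient.mk _ (x q) : Q) = q := fun q => Quotient.out_eq q
  have hy : ∀ q, (Quotient.mk _ (y q) : Q) = q := by
    intro q
    rw [← hx q]
    exact Quotient.sound ((Relation.EqvGen.rel _ _ (by
      have := (hf (x q)).2
      rw [hx q]; exact this)).symm)
  have hxi : Function.Injective x := Function.LeftInverse.injective hx
  have hyi : Function.Injective y := Function.LeftInverse.injective hy
  have hxy : ∀ q q', x q ≠ y q' := by
    intro q q' h
    have h1 : q = q' := by rw [← hx q, h, hy]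
    subst h1
    exact (hf (x q)).1 h.symm
  have hsat : ∀ S ∈ 𝒞, ∀ v w, (Quotient.mk _ v : Q) = Quotient.mk _ w → (v ∈ S ↔ w ∈ S) := by
    intro S hS v w h
    have h' : Relation.EqvGen r v w := Quotient.exact h
    induction h' with
    | rel a b hab => exact h𝒞 S hS a b hab
    | refl a => rfl
    | symm a b h1 ih => exact (ih (Quotient.sound h1)).symm
    | trans a b c h1 h2 ih1 ih2 =>
      exact (ih1 (Quotient.sound h1)).trans (ih2 (Quotient.sound h2))
  let U : Finset V → Finset Q := fun S => univ.filter (fun q => x q ∈ S)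
  have hUx : ∀ S q, q ∈ U S ↔ x q ∈ S := by intro S q; simp [U]
  have hUy : ∀ S ∈ 𝒞, ∀ q, q ∈ U S ↔ y q ∈ S := by
    intro S hS q
    rw [hUx]
    exact hsat S hS _ _ ((hx q).trans (hy q).symm)
  have hdisj : ∀ U₁ U₂ : Finset Q, Disjoint (U₁.image x) (U₂.image y) := by
    intro U₁ U₂
    rw [disjoint_left]
    intro a ha hb
    simp only [mem_image] at ha hb
    obtain ⟨q, _, rfl⟩ := ha
    obtain ⟨q', _, h⟩ := hb
    exact hxy q q' h.symm
  have hcard : ∀ U₁ U₂ : Finset Q, (U₁.image x ∪ U₂.image y).card = U₁.card + U₂.card := by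
    intro U₁ U₂
    rw [card_union_of_disjoint (hdisj _ _), card_image_of_injective _ hxi,
      card_image_of_injective _ hyi]
  have hle : ∀ S ∈ 𝒞, 2 * (U S).card ≤ s := by
    intro S hS
    rw [← hs S hS, two_mul, ← hcard]
    apply card_le_card
    intro v hv
    simp only [mem_union, mem_image] at hv
    rcases hv with ⟨q, hq, rfl⟩ | ⟨q, hq, rfl⟩
    · exact (hUx S q).1 hq
    · exact (hUy S hS q).1 hq
  have hle' : ∀ S ∈ 𝒞, 2 * ((U S)ᶜ).card ≤ Fintype.card V - s := by
    intro S hS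
    rw [← hs S hS, ← card_compl, two_mul, ← hcard]
    apply card_le_card
    intro v hv
    simp only [mem_union, mem_image, mem_compl] at hv ⊢
    rcases hv with ⟨q, hq, rfl⟩ | ⟨q, hq, rfl⟩
    · rwa [← hUx S q]
    · rwa [← hUy S hS q]
  have hex : ∀ p : Finset V × Finset V, ∃ T : Finset V, p ∈ 𝒞 ×ˢ 𝒞 →
      T.card = s ∧ (∀ q, x q ∈ T ↔ q ∈ U p.1) ∧ (∀ q, y q ∈ T ↔ q ∈ U p.2) := by
    rintro ⟨S₁, S₂⟩
    by_cases hp : (S₁, S₂) ∈ 𝒞 ×ˢ 𝒞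
    swap
    · exact ⟨∅, fun h => absurd h hp⟩
    have ⟨h₁, h₂⟩ := mem_product.1 hp
    simp only at h₁ h₂
    have hsV : s ≤ Fintype.card V := by rw [← hs S₁ h₁]; exact card_le_univ _
    have hsub : (U S₁).image x ∪ (U S₂).image y ⊆ ((U S₁)ᶜ.image x ∪ (U S₂)ᶜ.image y)ᶜ := by
      intro v hv
      simp only [mem_union, mem_image, mem_compl] at hv ⊢
      rintro (⟨q', hq', h'⟩ | ⟨q', hq', h'⟩) <;> rcases hv with ⟨q, hq, h⟩ | ⟨q, hq, h⟩
      · exact hq' (hxi (h'.trans h.symm) ▸ hq)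
      · exact hxy _ _ (h'.trans h.symm)
      · exact hxy _ _ (h.trans h'.symm)
      · exact hq' (hyi (h'.trans h.symm) ▸ hq)
    have hA : ((U S₁).image x ∪ (U S₂).image y).card ≤ s := by
      rw [hcard]
      have := hle S₁ h₁
      have := hle S₂ h₂
      omega
    have hB : s ≤ (((U S₁)ᶜ.image x ∪ (U S₂)ᶜ.image y)ᶜ).card := by
      rw [card_compl, hcard]
      have := hle' S₁ h₁
      have := hle' S₂ h₂
      omega
    obtain ⟨T, hAT, hTB, hT⟩ := exists_subsuperset_card_eq hsub hA hB
    refine ⟨T, fun _ => ⟨hT, fun q => ⟨fun h => ?_, fun h => ?_⟩, fun q => ⟨fun h => ?_, fun h => ?_⟩⟩⟩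
    · by_contra hq
      exact mem_compl.1 (hTB h) (mem_union_left _ (mem_image_of_mem _ (mem_compl.2 hq)))
    · exact hAT (mem_union_left _ (mem_image_of_mem _ h))
    · by_contra hq
      exact mem_compl.1 (hTB h) (mem_union_right _ (mem_image_of_mem _ (mem_compl.2 hq)))
    · exact hAT (mem_union_right _ (mem_image_of_mem _ h))
  choose g hg using hex
  have hUinj : ∀ S ∈ 𝒞, ∀ S' ∈ 𝒞, U S = U S' → S = S' := by
    intro S hS S' hS' h
    ext v
    rw [hsat S hS v _ (hx (Quotient.mk _ v)).symm, hsat S' hS' v _ (hx (Quotient.mk _ v)).symm,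
      ← hUx, ← hUx, h]
  calc 𝒞.card ^ 2 = (𝒞 ×ˢ 𝒞).card := by rw [card_product, sq]
    _ ≤ (powersetCard s (univ : Finset V)).card := by
      apply card_le_card_of_injOn g
      · intro p hp
        exact mem_powersetCard.2 ⟨subset_univ _, (hg p hp).1⟩
      · intro p hp p' hp' h
        have h1 := hg p hp
        have h2 := hg p' hp'
        have hp := mem_product.1 (mem_coe.1 hp)
        have hp' := mem_product.1 (mem_coe.1 hp')
        refine Prod.ext (hUinj _ hp.1 _ hp'.1 ?_) (hUinj _ hp.2 _ hp'.2 ?_)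
        · ext q; rw [← h1.2.1, ← h2.2.1, h]
        · ext q; rw [← h1.2.2, ← h2.2.2, h]
    _ = _ := by rw [card_powersetCard, card_univ]

end ClosedSets

section Links

variable {n : ℕ}

theorem LinkClosed.symm {F : Finset (Finset (Fin n))} {B S : Finset (Fin n)}
    (h : LinkClosed F B S) : LinkClosed F B ((S ∪ B)ᶜ) := by
  intro v hv w hw hwB
  simp only [mem_compl, mem_union, not_or, not_and_or, not_not] at hv hw
  rw [Finset.insert_comm]
  exact h w (hw.resolve_right hwB) v hv.1 hv.2

theorem LinkClosed.mono {F F' : Finset (Finset (Fin n))} {B S : Finset (Fin n)}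
    (hF : F ⊆ F') (h : LinkClosed F' B S) : LinkClosed F B S :=
  fun v hv w hw hwB he => h v hv w hw hwB (hF he)

theorem IsCoveringSystem.exists_neighbor {m : ℕ} {F : Finset (Finset (Fin n))}
    (hF : IsCoveringSystem n (m + 2) (m + 1) F) {B : Finset (Fin n)} (hB : B.card = m)
    {v : Fin n} (hv : v ∉ B) : ∃ w, w ≠ v ∧ w ∉ B ∧ insert v (insert w B) ∈ F := by
  obtain ⟨e, he, hsub⟩ := hF.2 (insert v B) (by rw [card_insert_of_notMem hv, hB])
  obtain ⟨w, hw⟩ : ∃ w, w ∉ insert v B ∧ insert w (insert v B) = e :=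
    exists_eq_insert_iff.2 ⟨hsub, by rw [card_insert_of_notMem hv, hB, hF.1 e he]⟩
  simp only [mem_insert, not_or] at hw
  exact ⟨w, hw.1.1, hw.1.2, by rw [Finset.insert_comm, hw.2]; exact he⟩

open scoped Classical in
theorem IsCoveringSystem.sq_card_linkClosed_le {m : ℕ} {F : Finset (Finset (Fin n))}
    (hF : IsCoveringSystem n (m + 2) (m + 1) F) {B : Finset (Fin n)} (hB : B.card = m) (s : ℕ) :
    ((powersetCard s Bᶜ).filter (LinkClosed F B)).card ^ 2 ≤ (n - m).choose s := by
  have key := sq_card_closed_le_choose (V := {v : Fin n // v ∉ B})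
    (fun v w => insert v.1 (insert w.1 B) ∈ F)
    (fun v => by
      obtain ⟨w, h1, h2, h3⟩ := hF.exists_neighbor hB v.2
      exact ⟨⟨w, h2⟩, fun h => h1 (congrArg Subtype.val h), h3⟩)
    s (((powersetCard s Bᶜ).filter (LinkClosed F B)).image (Finset.subtype (fun v => v ∉ B)))
    (by
      intro S hS
      obtain ⟨T, hT, rfl⟩ := mem_image.1 hS
      have hT := mem_powersetCard.1 (mem_filter.1 hT).1
      rw [card_subtype, filter_true_of_mem, hT.2]
      exact fun v hv => mem_compl.1 (hT.1 hv))
    (by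
      intro S hS v w hvw
      obtain ⟨T, hT, rfl⟩ := mem_image.1 hS
      have hT := (mem_filter.1 hT).2
      simp only [mem_subtype]
      refine ⟨fun h => ?_, fun h => ?_⟩
      · by_contra hw
        exact hT _ h _ hw w.2 hvw
      · by_contra hv
        exact hT _ h _ hv v.2 (by rw [Finset.insert_comm]; exact hvw))
  rw [card_image_of_injOn] at key
  · refine key.trans (le_of_eq ?_)
    rw [Fintype.card_subtype_compl, Fintype.card_fin, Fintype.card_coe, hB]
  · intro S hS T hT h
    have hS := mem_powersetCard.1 (mem_filter.1 hS).1
    have hT := mem_powersetCard.1 (mem_filter.1 hT).1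
    ext v
    by_cases hv : v ∈ B
    · exact ⟨fun h => absurd hv (mem_compl.1 (hS.1 h)), fun h => absurd hv (mem_compl.1 (hT.1 h))⟩
    · have := congrArg (fun X => (⟨v, hv⟩ : {v : Fin n // v ∉ B}) ∈ X) h
      simpa using this

/-- The preimage of the family `F` under the permutation `σ`. -/
def permFamily (F : Finset (Finset (Fin n))) (σ : Equiv.Perm (Fin n)) : Finset (Finset (Fin n)) :=
  univ.filter (fun e => e.map σ.toEmbedding ∈ F)

theorem mem_permFamily {F : Finset (Finset (Fin n))} {σ : Equiv.Perm (Fin n)}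
    {e : Finset (Fin n)} : e ∈ permFamily F σ ↔ e.map σ.toEmbedding ∈ F := by
  simp [permFamily]

theorem card_permFamily_le (F : Finset (Finset (Fin n))) (σ : Equiv.Perm (Fin n)) :
    (permFamily F σ).card ≤ F.card :=
  card_le_card_of_injOn (fun e => e.map σ.toEmbedding) (fun _ he => mem_permFamily.1 he)
    ((Finset.map_injective _).injOn)

theorem IsCoveringSystem.comap_perm {r k : ℕ} {F : Finset (Finset (Fin n))}
    (hF : IsCoveringSystem n r k F) (σ : Equiv.Perm (Fin n)) :
    IsCoveringSystem n r k (permFamily F σ) := by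
  refine ⟨fun e he => ?_, fun s hs => ?_⟩
  · rw [← hF.1 _ (mem_permFamily.1 he), card_map]
  · obtain ⟨e, he, hsub⟩ := hF.2 (s.map σ.toEmbedding) (by rw [card_map, hs])
    refine ⟨e.map σ.symm.toEmbedding, mem_permFamily.2 ?_, ?_⟩
    · rw [map_map]
      convert he
      ext v
      simp
    · intro v hv
      have : σ v ∈ e := hsub (mem_map_of_mem σ.toEmbedding hv)
      simpa using this

theorem linkClosed_permFamily_mul {F : Finset (Finset (Fin n))} {B S : Finset (Fin n)}
    (σ τ : Equiv.Perm (Fin n)) :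
    LinkClosed (permFamily F (σ * τ)) B S ↔
      LinkClosed (permFamily F σ) (B.map τ.toEmbedding) (S.map τ.toEmbedding) := by
  have hmap : ∀ X : Finset (Fin n),
      X.map (σ * τ).toEmbedding = (X.map τ.toEmbedding).map σ.toEmbedding := by
    intro X
    rw [map_map]
    rfl
  unfold LinkClosed
  constructor
  · intro h v hv w hw hwB
    have := h (τ.symm v) (by simpa using hv) (τ.symm w) (by simpa using hw) (by simpa using hwB)
    rw [mem_permFamily, hmap] at this
    rw [mem_permFamily]
    simpa [map_insert] using this
  · intro h v hv w hw hwB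
    have := h (τ v) (by simpa using hv) (τ w) (by simpa using hw) (by simpa using hwB)
    rw [mem_permFamily, hmap]
    rw [mem_permFamily] at this
    simpa [map_insert] using this

theorem exists_perm_map_eq {B S T : Finset (Fin n)} (hS : S ⊆ Bᶜ) (hT : T ⊆ Bᶜ)
    (h : S.card = T.card) :
    ∃ τ : Equiv.Perm (Fin n), B.map τ.toEmbedding = B ∧ S.map τ.toEmbedding = T := by
  have hcard : ∀ X ⊆ Bᶜ, (X.subtype (fun v => v ∉ B)).card = X.card := by
    intro X hX
    rw [card_subtype, filter_true_of_mem]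
    exact fun v hv => mem_compl.1 (hX hv)
  let e : {v // v ∈ S.subtype (fun v => v ∉ B)} ≃ {v // v ∈ T.subtype (fun v => v ∉ B)} :=
    equivOfCardEq (by rw [hcard S hS, hcard T hT, h])
  let ρ : Equiv.Perm {v : Fin n // v ∉ B} := e.extendSubtype
  refine ⟨Equiv.Perm.ofSubtype ρ, ?_, ?_⟩
  · refine eq_of_subset_of_card_le ?_ (by rw [card_map])
    intro v hv
    obtain ⟨w, hw, rfl⟩ := mem_map.1 hv
    have : Equiv.Perm.ofSubtype ρ w = w :=
      Equiv.Perm.ofSubtype_apply_of_not_mem ρ (not_not.2 hw)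
    simpa [this] using hw
  · refine eq_of_subset_of_card_le ?_ (by rw [card_map, h])
    intro v hv
    obtain ⟨w, hw, rfl⟩ := mem_map.1 hv
    have hwB : w ∉ B := mem_compl.1 (hS hw)
    have h1 : Equiv.Perm.ofSubtype ρ w = ρ ⟨w, hwB⟩ := Equiv.Perm.ofSubtype_apply_of_mem ρ hwB
    have h2 := e.extendSubtype_mem ⟨w, hwB⟩ (by simpa using hw)
    simpa [h1, ρ] using h2

open scoped Classical in
theorem card_perm_linkClosed_eq (F : Finset (Finset (Fin n))) {B S T : Finset (Fin n)}
    (hS : S ⊆ Bᶜ) (hT : T ⊆ Bᶜ) (h : S.card = T.card) :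
    (univ.filter (fun σ => LinkClosed (permFamily F σ) B S)).card =
      (univ.filter (fun σ => LinkClosed (permFamily F σ) B T)).card := by
  obtain ⟨τ, hτB, hτS⟩ := exists_perm_map_eq hS hT h
  refine card_bij (fun σ _ => σ * τ⁻¹) ?_ ?_ ?_
  · intro σ hσ
    have hσ := (mem_filter.1 hσ).2
    refine mem_filter.2 ⟨mem_univ _, ?_⟩
    have := (linkClosed_permFamily_mul (F := F) (B := B) (S := S) (σ * τ⁻¹) τ).1 (by simpa using hσ)
    rwa [hτB, hτS] at this
  · intro a _ b _ hab
    simpa using hab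
  · intro σ hσ
    have hσ := (mem_filter.1 hσ).2
    refine ⟨σ * τ, mem_filter.2 ⟨mem_univ _, ?_⟩, by simp⟩
    rw [linkClosed_permFamily_mul, hτB, hτS]
    exact hσ

open scoped Classical in
theorem IsCoveringSystem.sq_card_perm_linkClosed_mul_choose_le {m : ℕ}
    {F : Finset (Finset (Fin n))} (hF : IsCoveringSystem n (m + 2) (m + 1) F)
    {B S : Finset (Fin n)} (hB : B.card = m) (hS : S ⊆ Bᶜ) :
    (univ.filter (fun σ => LinkClosed (permFamily F σ) B S)).card ^ 2 * (n - m).choose S.card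
      ≤ n.factorial ^ 2 := by
  set K := (univ.filter (fun σ => LinkClosed (permFamily F σ) B S)).card
  set b := (n - m).choose S.card
  have hBc : (Bᶜ).card = n - m := by rw [card_compl, Fintype.card_fin, hB]
  have hb : 0 < b := Nat.choose_pos (by rw [← hBc]; exact card_le_card hS)
  have hdc : b * K = ∑ σ : Equiv.Perm (Fin n),
      ((powersetCard S.card Bᶜ).filter (LinkClosed (permFamily F σ) B)).card := by
    have h1 : ∑ T ∈ powersetCard S.card Bᶜ,
        (univ.filter (fun σ => LinkClosed (permFamily F σ) B T)).card = b * K := by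
      rw [sum_const_nat (m := K), card_powersetCard, hBc]
      intro T hT
      have hT := mem_powersetCard.1 hT
      exact card_perm_linkClosed_eq F hT.1 hS hT.2
    rw [← h1]
    simp only [card_filter]
    rw [sum_comm]
  have hcs : (b * K) ^ 2 ≤ n.factorial ^ 2 * b := by
    rw [hdc]
    refine sq_sum_le_card_mul_sum_sq.trans ?_
    rw [card_univ, Fintype.card_perm, Fintype.card_fin, sq, mul_assoc]
    refine Nat.mul_le_mul_left _ ?_
    refine (sum_le_card_nsmul _ _ b fun σ _ => (hF.comap_perm σ).sq_card_linkClosed_le hB _).trans ?_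
    rw [card_univ, Fintype.card_perm, Fintype.card_fin, smul_eq_mul]
  refine Nat.le_of_mul_le_mul_right ?_ hb
  calc K ^ 2 * b * b = (b * K) ^ 2 := by ring
    _ ≤ _ := hcs

/-- The nonempty subsets of the complement of `B` that may occur as the smaller side of a cut
in a link without isolated vertices. -/
def smallSides (B : Finset (Fin n)) : Finset (Finset (Fin n)) :=
  (Icc 2 ((Bᶜ).card / 2)).biUnion (fun s => powersetCard s Bᶜ)

theorem mem_smallSides {B S : Finset (Fin n)} :
    S ∈ smallSides B ↔ S ⊆ Bᶜ ∧ 2 ≤ S.card ∧ S.card ≤ (Bᶜ).card / 2 := by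
  simp only [smallSides, mem_biUnion, mem_Icc, mem_powersetCard]
  constructor
  · rintro ⟨s, hs, h, rfl⟩
    exact ⟨h, hs⟩
  · rintro ⟨h, hs⟩
    exact ⟨_, hs, h, rfl⟩

theorem choose_two_le_choose {N s : ℕ} (hs : 2 ≤ s) (hsN : s ≤ N / 2) :
    N.choose 2 ≤ N.choose s := by
  induction s, hs using Nat.le_induction with
  | base => rfl
  | succ s hs ih =>
    exact (ih (by omega)).trans (Nat.choose_le_succ_of_lt_half_left (by omega))

open scoped Classical in
theorem IsCoveringSystem.sum_smallSides_le {m : ℕ}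
    {F : Finset (Finset (Fin n))} (hF : IsCoveringSystem n (m + 2) (m + 1) F)
    {B : Finset (Fin n)} (hB : B.card = m) (hN : 1 ≤ n - m) :
    (∑ S ∈ smallSides B, (univ.filter (fun σ => LinkClosed (permFamily F σ) B S)).card ^ 4) *
      (n - m - 1) ≤ n.factorial ^ 4 := by
  have hBc : (Bᶜ).card = n - m := by rw [card_compl, Fintype.card_fin, hB]
  set N := n - m with hNdef
  have hlevel : ∀ s ∈ Icc 2 (N / 2),
      (∑ S ∈ powersetCard s Bᶜ,
        (univ.filter (fun σ => LinkClosed (permFamily F σ) B S)).card ^ 4) * N.choose 2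
        ≤ n.factorial ^ 4 := by
    intro s hs
    rw [mem_Icc] at hs
    have hb : 0 < N.choose s := Nat.choose_pos (by omega)
    refine (Nat.mul_le_mul_left _ (choose_two_le_choose hs.1 hs.2)).trans ?_
    refine Nat.le_of_mul_le_mul_right ?_ hb
    rw [mul_assoc, ← sq, sum_mul]
    refine (sum_le_card_nsmul _ _ (n.factorial ^ 4) fun S hS => ?_).trans ?_
    · have hS := mem_powersetCard.1 hS
      have h := hF.sq_card_perm_linkClosed_mul_choose_le hB hS.1
      rw [hS.2] at h
      calc _ = (_ ^ 2 * N.choose s) ^ 2 := by ring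
        _ ≤ (n.factorial ^ 2) ^ 2 := Nat.pow_le_pow_left h 2
        _ = _ := by ring
    · rw [card_powersetCard, hBc, smul_eq_mul, mul_comm]
  rw [smallSides, hBc, sum_biUnion
    (fun s _ t _ hst => pairwise_disjoint_powersetCard Bᶜ hst)]
  set X := ∑ s ∈ Icc 2 (N / 2), ∑ S ∈ powersetCard s Bᶜ,
    (univ.filter (fun σ => LinkClosed (permFamily F σ) B S)).card ^ 4
  have hX : X * N.choose 2 ≤ (N / 2) * n.factorial ^ 4 := by
    rw [sum_mul]
    refine (sum_le_card_nsmul _ _ _ hlevel).trans ?_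
    rw [smul_eq_mul, Nat.card_Icc]
    exact Nat.mul_le_mul_right _ (by omega)
  have h2 : N.choose 2 * 2 = N * (N - 1) := by
    rw [Nat.choose_two_right]
    exact Nat.div_mul_cancel (Nat.even_mul_pred_self N).two_dvd
  refine Nat.le_of_mul_le_mul_left ?_ hN
  calc N * (X * (N - 1)) = X * N.choose 2 * 2 := by rw [mul_assoc X, h2]; ring
    _ ≤ (N / 2) * n.factorial ^ 4 * 2 := Nat.mul_le_mul_right _ hX
    _ = (N / 2 * 2) * n.factorial ^ 4 := by ring
    _ ≤ N * n.factorial ^ 4 := Nat.mul_le_mul_right _ (Nat.div_mul_le_self N 2)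

open scoped Classical in
/-- Four suitable permuted copies of a covering system have few disconnected links. -/
theorem IsCoveringSystem.exists_perms {m : ℕ}
    {F : Finset (Finset (Fin n))} (hF : IsCoveringSystem n (m + 2) (m + 1) F)
    (hN : 1 ≤ n - m) :
    ∃ σ : Fin 4 → Equiv.Perm (Fin n),
      (∑ B ∈ powersetCard m (univ : Finset (Fin n)), ((smallSides B).filter
        (fun S => ∀ i, LinkClosed (permFamily F (σ i)) B S)).card) * (n - m - 1)
        ≤ n.choose m := by
  have hsum : ∑ σ : Fin 4 → Equiv.Perm (Fin n),
      (∑ B ∈ powersetCard m (univ : Finset (Fin n)), ((smallSides B).filter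
        (fun S => ∀ i, LinkClosed (permFamily F (σ i)) B S)).card) * (n - m - 1)
      ≤ ∑ _σ : Fin 4 → Equiv.Perm (Fin n), n.choose m := by
    rw [← sum_mul, sum_comm]
    have hB : ∀ B : Finset (Fin n), ∑ σ : Fin 4 → Equiv.Perm (Fin n), ((smallSides B).filter
        (fun S => ∀ i, LinkClosed (permFamily F (σ i)) B S)).card =
        ∑ S ∈ smallSides B,
          (univ.filter (fun σ => LinkClosed (permFamily F σ) B S)).card ^ 4 := by
      intro B
      simp only [card_filter]
      rw [sum_comm]
      refine sum_congr rfl fun S _ => ?_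
      rw [Fintype.sum_pow]
      refine sum_congr rfl fun σ _ => ?_
      rw [prod_boole]
      simp
    simp only [hB]
    rw [sum_mul]
    refine (sum_le_card_nsmul _ _ (n.factorial ^ 4) fun B hB' =>
      hF.sum_smallSides_le (mem_powersetCard.1 hB').2 hN).trans ?_
    simp [Fintype.card_perm, mul_comm]
  obtain ⟨σ, _, hσ⟩ := exists_le_of_sum_le univ_nonempty hsum
  exact ⟨σ, hσ⟩

theorem exists_isCoveringSystem_card_eq_coverNum {k : ℕ} (hk : k < n) :
    ∃ F, IsCoveringSystem n (k + 1) k F ∧ F.card = coverNum n (k + 1) k := by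
  refine Nat.sInf_mem (s := {m | ∃ F, IsCoveringSystem n (k + 1) k F ∧ F.card = m})
    ⟨_, powersetCard (k + 1) univ, ⟨fun e he => (mem_powersetCard.1 he).2, fun s hs => ?_⟩, rfl⟩
  obtain ⟨e, hse, he⟩ := exists_superset_card_eq (s := s) (n := k + 1) (by omega) (by simpa using hk)
  exact ⟨e, mem_powersetCard.2 ⟨subset_univ _, he⟩, hse⟩

theorem IsCoveringSystem.choose_le {k : ℕ} {F : Finset (Finset (Fin n))}
    (hF : IsCoveringSystem n (k + 1) k F) : n.choose k ≤ F.card * (k + 1) := by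
  calc n.choose k = (powersetCard k (univ : Finset (Fin n))).card := by simp
    _ ≤ (F.biUnion (powersetCard k)).card := by
      apply card_le_card
      intro s hs
      have hs := (mem_powersetCard.1 hs).2
      obtain ⟨e, he, hse⟩ := hF.2 s hs
      exact mem_biUnion.2 ⟨e, he, mem_powersetCard.2 ⟨hse, hs⟩⟩
    _ ≤ F.card * (k + 1) := card_biUnion_le_card_mul _ _ _ fun e he => by
      rw [card_powersetCard, hF.1 e he, Nat.choose_succ_self_right]

/-- A family whose links have no isolated vertices becomes connected in all links after adding
one set for every closed small side. -/
theorem exists_linksConnected (m : ℕ) (G : Finset (Finset (Fin n)))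
    (hcard : ∀ e ∈ G, e.card = m + 2)
    (hG : ∀ B : Finset (Fin n), B.card = m → ∀ v ∉ B, ∃ w, w ≠ v ∧ w ∉ B ∧
      insert v (insert w B) ∈ G)
    (D : Finset (Fin n) → Finset (Finset (Fin n)))
    (hD : ∀ B S, S ∈ smallSides B → LinkClosed G B S → S ∈ D B)
    (hD' : ∀ B, D B ⊆ smallSides B) :
    ∃ G' : Finset (Finset (Fin n)), (∀ e ∈ G', e.card = m + 2) ∧ LinksConnected G' m ∧
      G'.card ≤ G.card + ∑ B ∈ powersetCard m (univ : Finset (Fin n)), (D B).card := by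
  have hedge : ∀ B S : Finset (Fin n), ∃ e : Finset (Fin n), S ∈ smallSides B →
      ∃ v ∈ S, ∃ w ∉ S, w ∉ B ∧ e = insert v (insert w B) := by
    intro B S
    by_cases hS : S ∈ smallSides B
    swap
    · exact ⟨∅, fun h => absurd h hS⟩
    obtain ⟨h1, h2, h3⟩ := mem_smallSides.1 hS
    obtain ⟨v, hv⟩ := card_pos.1 (show 0 < S.card by omega)
    obtain ⟨w, hw, hwS⟩ := exists_mem_notMem_of_card_lt_card (show S.card < (Bᶜ).card by omega)
    exact ⟨_, fun _ => ⟨v, hv, w, hwS, mem_compl.1 hw, rfl⟩⟩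
  choose E hE using hedge
  refine ⟨G ∪ (powersetCard m univ).biUnion (fun B => (D B).image (E B)), ?_, ?_, ?_⟩
  · intro e he
    rcases mem_union.1 he with he | he
    · exact hcard e he
    · obtain ⟨B, hB, he⟩ := mem_biUnion.1 he
      obtain ⟨S, hS, rfl⟩ := mem_image.1 he
      have hS := hD' B hS
      obtain ⟨v, hv, w, hw, hwB, h⟩ := hE B S hS
      have hvB : v ∉ B := mem_compl.1 ((mem_smallSides.1 hS).1 hv)
      rw [h, card_insert_of_notMem, card_insert_of_notMem hwB, (mem_powersetCard.1 hB).2]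
      simp only [mem_insert, not_or]
      exact ⟨fun h => hw (h ▸ hv), hvB⟩
  · have hsmall : ∀ B S : Finset (Fin n), B.card = m → S.Nonempty → S ⊆ Bᶜ →
        S.card ≤ (Bᶜ).card / 2 → ¬ LinkClosed
          (G ∪ (powersetCard m univ).biUnion (fun B => (D B).image (E B))) B S := by
      intro B S hB hS hSB hle hcl
      have h2 : 2 ≤ S.card := by
        obtain ⟨v, hv⟩ := hS
        obtain ⟨w, hwv, hwB, he⟩ := hG B hB v (mem_compl.1 (hSB hv))
        have hw : w ∈ S := by
          by_contra hw
          exact hcl v hv w hw hwB (mem_union_left _ he)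
        exact one_lt_card.2 ⟨w, hw, v, hv, hwv⟩
      have hS' : S ∈ smallSides B := mem_smallSides.2 ⟨hSB, h2, hle⟩
      obtain ⟨v, hv, w, hw, hwB, h⟩ := hE B S hS'
      refine hcl v hv w hw hwB (mem_union_right _ (mem_biUnion.2
        ⟨B, mem_powersetCard.2 ⟨subset_univ _, hB⟩, mem_image.2 ⟨S, ?_, h⟩⟩))
      exact hD B S hS' (hcl.mono subset_union_left)
    intro B S hB hS hSB hcl v
    by_contra hv
    rw [not_or] at hv
    have hSB' : S ⊆ Bᶜ := fun u hu => mem_compl.2 (disjoint_left.1 hSB hu)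
    by_cases hle : S.card ≤ (Bᶜ).card / 2
    · exact hsmall B S hB hS hSB' hle hcl
    · refine hsmall B _ hB ⟨v, by simp [hv]⟩ ?_ ?_ hcl.symm
      · exact compl_subset_compl.2 subset_union_right
      · rw [card_compl, card_union_of_disjoint hSB]
        rw [card_compl] at hle ⊢
        omega
  · refine (card_union_le _ _).trans (Nat.add_le_add_left ?_ _)
    exact card_biUnion_le.trans (sum_le_sum fun B _ => card_image_le)

theorem exists_linksConnected_card_le {m : ℕ} (hmn : m + 1 < n)
    (hk : (m + 1) * (m + 2) ≤ 2 * ((n - m) * (n - m - 1))) :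
    ∃ G : Finset (Finset (Fin n)), (∀ e ∈ G, e.card = m + 2) ∧ LinksConnected G m ∧
      G.card ≤ 6 * coverNum n (m + 2) (m + 1) := by
  classical
  obtain ⟨F, hF, hFc⟩ := exists_isCoveringSystem_card_eq_coverNum hmn
  have hlow := hF.choose_le
  rw [← hFc]
  obtain ⟨σ, hσ⟩ := hF.exists_perms (by omega)
  set X := ∑ B ∈ powersetCard m (univ : Finset (Fin n)), ((smallSides B).filter
        (fun S => ∀ i, LinkClosed (permFamily F (σ i)) B S)).card with hX
  obtain ⟨G, h1, h2, h3⟩ := exists_linksConnected m (univ.biUnion fun i => permFamily F (σ i))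
    (by
      intro e he
      obtain ⟨i, _, he⟩ := mem_biUnion.1 he
      exact (hF.comap_perm (σ i)).1 e he)
    (by
      intro B hB v hv
      obtain ⟨w, hw1, hw2, hw3⟩ := (hF.comap_perm (σ 0)).exists_neighbor hB hv
      exact ⟨w, hw1, hw2, mem_biUnion.2 ⟨0, mem_univ _, hw3⟩⟩)
    (fun B => (smallSides B).filter (fun S => ∀ i, LinkClosed (permFamily F (σ i)) B S))
    (by
      intro B S hS hcl
      exact mem_filter.2 ⟨hS, fun i => hcl.mono (subset_biUnion_of_mem
        (fun i => permFamily F (σ i)) (mem_univ i))⟩)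
    (fun B => filter_subset _ _)
  refine ⟨G, h1, h2, h3.trans ?_⟩
  have h4 : (univ.biUnion fun i => permFamily F (σ i)).card ≤ 4 * F.card := by
    refine (card_biUnion_le_card_mul _ _ F.card fun i _ => card_permFamily_le F (σ i)).trans ?_
    simp
  have h5 : X ≤ 2 * F.card := by
    have hpos : 0 < (n - m) * (n - m - 1) := Nat.mul_pos (by omega) (by omega)
    refine Nat.le_of_mul_le_mul_right ?_ hpos
    calc X * ((n - m) * (n - m - 1)) = X * (n - m - 1) * (n - m) := by ring
      _ ≤ n.choose m * (n - m) := Nat.mul_le_mul_right _ hσ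
      _ = n.choose (m + 1) * (m + 1) := (Nat.choose_succ_right_eq n m).symm
      _ ≤ F.card * (m + 1 + 1) * (m + 1) := Nat.mul_le_mul_right _ hlow
      _ = F.card * ((m + 1) * (m + 2)) := by ring
      _ ≤ F.card * (2 * ((n - m) * (n - m - 1))) := Nat.mul_le_mul_left _ hk
      _ = 2 * F.card * ((n - m) * (n - m - 1)) := by ring
  rw [← hX]
  omega

end Links

section Propagation

variable {n : ℕ}

theorem UcpDeriv.mono {φ ψ : CnfFormula n} (h : φ ⊆ ψ) {l : Lit n} (hl : UcpDeriv φ l) :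
    UcpDeriv ψ l := by
  induction hl with
  | step C hC l hl _ ih => exact .step C (h hC) l hl ih

theorem UcpBot.mono {φ ψ : CnfFormula n} (h : φ ⊆ ψ) : UcpBot φ → UcpBot ψ := by
  rintro ⟨C, hC, hl⟩
  exact ⟨C, h hC, fun l hlC => (hl l hlC).mono h⟩

theorem UcpDeriv.bot {φ : CnfFormula n} {l : Lit n} (h : UcpDeriv φ l)
    (h' : UcpDeriv φ (negLit l)) : UcpBot φ := by
  cases h with
  | step C hC _ hl h =>
    refine ⟨C, hC, fun l' hl' => ?_⟩
    by_cases hll : l' = l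
    · rwa [hll]
    · exact h l' (mem_erase.2 ⟨hll, hl'⟩)

/-- The clause on the variables `e` whose only positive literal is `h`. -/
def hornClause (e : Finset (Fin n)) (h : Fin n) : Clause n :=
  e.image (fun v => (v, decide (v = h)))

/-- All clauses `hornClause e h` with `h ∈ e ∈ G`. -/
def hornFormula (G : Finset (Finset (Fin n))) : CnfFormula n :=
  G.biUnion (fun e => e.image (hornClause e))

theorem card_hornFormula_le {r : ℕ} {G : Finset (Finset (Fin n))} (hG : ∀ e ∈ G, e.card = r) :
    (hornFormula G).card ≤ G.card * r :=
  card_biUnion_le_card_mul _ _ _ fun e he => card_image_le.trans (hG e he).le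

theorem hornClause_wf (e : Finset (Fin n)) (h : Fin n) : (hornClause e h).Wf := by
  intro l hl l' hl' hll
  obtain ⟨v, _, rfl⟩ := mem_image.1 hl
  obtain ⟨w, _, rfl⟩ := mem_image.1 hl'
  simp only at hll
  rw [hll]

theorem hornFormula_subset_psi {k : ℕ} {G : Finset (Finset (Fin n))}
    (hG : ∀ e ∈ G, e.card = k + 1) : hornFormula G ⊆ Psi n k := by
  intro C hC
  obtain ⟨e, he, hC⟩ := mem_biUnion.1 hC
  obtain ⟨h, hh, rfl⟩ := mem_image.1 hC
  have hinj : Function.Injective (fun v : Fin n => (v, decide (v = h))) :=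
    fun v w hvw => (Prod.ext_iff.1 hvw).1
  refine mem_filter.2 ⟨mem_univ _, hornClause_wf e h, ?_, ?_⟩
  · rw [hornClause, filter_image, card_image_of_injective _ hinj]
    simp only [decide_eq_false_iff_not]
    rw [filter_ne' e h, card_erase_of_mem hh, hG e he]
    rfl
  · rw [hornClause, filter_image, card_image_of_injective _ hinj]
    simp only [decide_eq_true_eq]
    rw [filter_eq' e h, if_pos hh, card_singleton]

theorem exists_of_mem_psi {k : ℕ} {C : Clause n} (hC : C ∈ Psi n k) :
    ∃ (A : Finset (Fin n)) (h : Fin n), A.card = k ∧ h ∉ A ∧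
      ∀ l, l ∈ C ↔ (l = (h, true) ∨ ∃ v ∈ A, l = (v, false)) := by
  obtain ⟨_, hwf, hneg, hpos⟩ := mem_filter.1 hC
  obtain ⟨p, hp⟩ := card_eq_one.1 hpos
  have hp' : p ∈ C ∧ p.2 = true := mem_filter.1 (hp ▸ mem_singleton_self p)
  refine ⟨(C.filter (fun l => l.2 = false)).image Prod.fst, p.1, ?_, ?_, ?_⟩
  · rw [card_image_of_injOn, hneg]
    intro l hl l' hl' h
    exact hwf l (mem_filter.1 hl).1 l' (mem_filter.1 hl').1 h
  · intro h
    obtain ⟨l, hl, hlp⟩ := mem_image.1 h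
    have hl := mem_filter.1 hl
    have := hwf l hl.1 p hp'.1 hlp
    rw [this, hp'.2] at hl
    exact absurd hl.2 (by simp)
  · rintro ⟨v, b⟩
    constructor
    · intro h
      cases b
      · exact Or.inr ⟨v, mem_image.2 ⟨(v, false), mem_filter.2 ⟨h, rfl⟩, rfl⟩, rfl⟩
      · left
        have : (v, true) ∈ C.filter (fun l => l.2 = true) := mem_filter.2 ⟨h, rfl⟩
        rw [hp, mem_singleton] at this
        rw [← this]
    · rintro (h | ⟨w, hw, h⟩)
      · rw [h, ← hp'.2]
        exact hp'.1
      · obtain ⟨l, hl, rfl⟩ := mem_image.1 hw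
        have hl := mem_filter.1 hl
        rw [h, ← hl.2]
        exact hl.1

theorem ucpDeriv_of_hornClause {φ : CnfFormula n} {e : Finset (Fin n)} {h v : Fin n}
    (hC : hornClause e h ∈ φ) (hv : v ∈ e)
    (H : ∀ u ∈ e, u ≠ v → UcpDeriv φ (u, decide (u ≠ h))) :
    UcpDeriv φ (v, decide (v = h)) := by
  refine .step _ hC _ (mem_image_of_mem _ hv) fun l hl => ?_
  obtain ⟨hne, hl⟩ := mem_erase.1 hl
  obtain ⟨u, hu, rfl⟩ := mem_image.1 hl
  have huv : u ≠ v := fun h => hne (by rw [h])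
  have := H u hu huv
  simpa [negLit] using this

theorem ucpDeriv_true_of_card {m : ℕ} {G : Finset (Finset (Fin n))} (hG : LinksConnected G m)
    {φ : CnfFormula n} (hφ : hornFormula G ⊆ φ) {A : Finset (Fin n)} (hA : A.card = m + 1)
    (hd : ∀ v ∈ A, UcpDeriv φ (v, true)) (v : Fin n) : UcpDeriv φ (v, true) := by
  classical
  obtain ⟨a, ha⟩ := card_pos.1 (show 0 < A.card by omega)
  have hB : ∀ u ∈ A.erase a, UcpDeriv φ (u, true) := fun u hu => hd u (mem_of_mem_erase hu)
  have := hG (A.erase a) (univ.filter (fun u => UcpDeriv φ (u, true) ∧ u ∉ A.erase a))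
    (by rw [card_erase_of_mem ha, hA]; rfl) ⟨a, by simp [hd a ha]⟩
    (disjoint_left.2 fun u hu => (mem_filter.1 hu).2.2) ?_ v
  · rcases this with h | h
    · exact (mem_filter.1 h).2.1
    · exact hB v h
  · intro u hu w hw hwB he
    have hu := (mem_filter.1 hu).2
    refine hw (mem_filter.2 ⟨mem_univ _, ?_, hwB⟩)
    have hwe : w ∈ insert u (insert w (A.erase a)) := by simp
    have := ucpDeriv_of_hornClause (h := w) (v := w)
      (hφ (mem_biUnion.2 ⟨_, he, mem_image_of_mem _ hwe⟩)) hwe ?_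
    · simpa using this
    · intro x hx hxw
      simp only [ne_eq, hxw, not_false_eq_true, decide_true]
      rcases mem_insert.1 hx with rfl | hx
      · exact hu.1
      · exact hB x ((mem_insert.1 hx).resolve_left hxw)

theorem ucpDeriv_of_card_of_false {m : ℕ} {G : Finset (Finset (Fin n))} (hG : LinksConnected G m)
    {φ : CnfFormula n} (hφ : hornFormula G ⊆ φ) (hbot : ¬ UcpBot φ) {B : Finset (Fin n)}
    (hB : B.card = m) (hd : ∀ v ∈ B, UcpDeriv φ (v, true)) {h : Fin n}
    (hh : UcpDeriv φ (h, false)) (v : Fin n) (hv : v ∉ B) : UcpDeriv φ (v, false) := by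
  classical
  have hdisj : ∀ u, UcpDeriv φ (u, false) → u ∉ B := fun u hu huB => hbot ((hd u huB).bot hu)
  have := hG B (univ.filter (fun u => UcpDeriv φ (u, false))) hB ⟨h, by simp [hh]⟩
    (disjoint_left.2 fun u hu => hdisj u (mem_filter.1 hu).2) ?_ v
  · exact (mem_filter.1 (this.resolve_right hv)).2
  · intro u hu w hw hwB he
    have hu := (mem_filter.1 hu).2
    have hwu : w ≠ u := fun h => hw (mem_filter.2 ⟨mem_univ _, h ▸ hu⟩)
    refine hw (mem_filter.2 ⟨mem_univ _, ?_⟩)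
    have := ucpDeriv_of_hornClause (h := u) (v := w)
      (hφ (mem_biUnion.2 ⟨_, he, mem_image_of_mem _ (mem_insert_self u _)⟩))
      (by simp) ?_
    · simpa [hwu] using this
    · intro x hx hxw
      by_cases hxu : x = u
      · simpa [hxu] using hu
      · simp only [ne_eq, hxu, not_false_eq_true, decide_true]
        exact hd x ((mem_insert.1 ((mem_insert.1 hx).resolve_left hxu)).resolve_left hxw)

theorem ucpEquiv_hornFormula {m : ℕ} {G : Finset (Finset (Fin n))}
    (hcard : ∀ e ∈ G, e.card = m + 2) (hG : LinksConnected G m) :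
    UcpEquiv (hornFormula G) (Psi n (m + 1)) := by
  intro α _
  have hsub : hornFormula G ∪ unitClauses α ⊆ Psi n (m + 1) ∪ unitClauses α :=
    union_subset_union_left (hornFormula_subset_psi hcard)
  have hφ : hornFormula G ⊆ hornFormula G ∪ unitClauses α := subset_union_left
  set φ := hornFormula G ∪ unitClauses α
  set ψ := Psi n (m + 1) ∪ unitClauses α
  have hder : ¬ UcpBot φ → ∀ l, UcpDeriv ψ l → UcpDeriv φ l := by
    intro hbot l hl
    induction hl with
    | step C hC l hl _ ih =>
      rcases mem_union.1 hC with hC | hC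
      swap
      · exact .step C (mem_union_right _ hC) l hl ih
      obtain ⟨A, h, hA, hhA, hAC⟩ := exists_of_mem_psi hC
      rcases (hAC l).1 hl with rfl | ⟨v, hv, rfl⟩
      · refine ucpDeriv_true_of_card hG hφ hA (fun u hu => ?_) h
        exact ih (u, false) (mem_erase.2 ⟨by simp, (hAC _).2 (Or.inr ⟨u, hu, rfl⟩)⟩)
      · refine ucpDeriv_of_card_of_false hG hφ hbot (B := A.erase v)
          (by rw [card_erase_of_mem hv, hA]; rfl) (fun u hu => ?_) (h := h) ?_ v (notMem_erase v A)
        · have hu := mem_erase.1 hu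
          exact ih (u, false) (mem_erase.2 ⟨by simp [hu.1], (hAC _).2 (Or.inr ⟨u, hu.2, rfl⟩)⟩)
        · exact ih (h, true) (mem_erase.2 ⟨by simp, (hAC _).2 (Or.inl rfl)⟩)
  refine ⟨⟨UcpBot.mono hsub, fun hψ => ?_⟩, fun hbot => ?_⟩
  · by_contra hbot
    obtain ⟨C, hC, hl⟩ := hψ
    have hl' := fun l hlC => hder hbot _ (hl l hlC)
    rcases mem_union.1 hC with hC | hC
    swap
    · exact hbot ⟨C, mem_union_right _ hC, hl'⟩
    obtain ⟨A, h, hA, hhA, hAC⟩ := exists_of_mem_psi hC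
    have h1 := ucpDeriv_true_of_card hG hφ hA
      (fun u hu => hl' (u, false) ((hAC _).2 (Or.inr ⟨u, hu, rfl⟩))) h
    exact hbot (h1.bot (hl' (h, true) ((hAC _).2 (Or.inl rfl))))
  · ext l
    exact ⟨fun h => UcpDeriv.mono hsub h, fun h => hder hbot l h⟩

end Propagation

/-- For every integer constant `c ≥ 0` there exists `n₀` such that for every
`n ≥ n₀` and every integer `k` with `|2k − n| ≤ c`, there exists a CNF formula
ucp-equivalent to `Ψ_{n,k}` with at most `6 · (k+1) · C(n, k+1, k)` clauses. -/
theorem exists_small_ucpEquivalent_psi :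
    ∀ c : ℕ, ∃ n₀ : ℕ, ∀ n : ℕ, n₀ ≤ n → ∀ k : ℕ, |2 * (k : ℤ) - (n : ℤ)| ≤ (c : ℤ) →
      ∃ φ : CnfFormula n, (∀ C ∈ φ, Clause.Wf C) ∧
        UcpEquiv φ (Psi n k) ∧
        φ.card ≤ 6 * (k + 1) * coverNum n (k + 1) k := by
  intro c
  refine ⟨7 * c + 4, fun n hn k hk => ?_⟩
  obtain ⟨hk1, hk2⟩ := abs_le.1 hk
  obtain ⟨m, rfl⟩ : ∃ m, k = m + 1 := ⟨k - 1, by omega⟩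
  obtain ⟨d, rfl⟩ : ∃ d, n = m + 1 + d := ⟨n - (m + 1), by omega⟩
  have hd : 3 * c + 2 ≤ d := by omega
  have hmd : m + 1 ≤ d + c := by omega
  obtain ⟨G, hcard, hG, hle⟩ := exists_linksConnected_card_le (n := m + 1 + d) (m := m)
    (by omega) (by
      rw [show m + 1 + d - m = d + 1 by omega, Nat.add_sub_cancel]
      nlinarith)
  refine ⟨hornFormula G, fun C hC => ?_, ucpEquiv_hornFormula hcard hG, ?_⟩
  · exact (Finset.mem_filter.1 (hornFormula_subset_psi hcard hC)).2.1
  · calc (hornFormula G).card ≤ G.card * (m + 2) := card_hornFormula_le hcard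
      _ ≤ 6 * coverNum (m + 1 + d) (m + 2) (m + 1) * (m + 2) := Nat.mul_le_mul_right _ hle
      _ = 6 * (m + 1 + 1) * coverNum (m + 1 + d) (m + 1 + 1) (m + 1) := by ring
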